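/- Let d ≥ 2 and let u = (u₁,…,u_d) be a uniformly random unit vector in ℝ^d. Then for every c with 0 < c ≤ 1, P[|u₁| ≥ √(c/d)] ≥ P[|G| ≥ √c], where G is a standard Gaussian random variable. -/

import Mathlib

open MeasureTheory ProbabilityTheory Real

/-- The standard Gaussian product measure has the product density. -/
lemma pi_gaussianReal_eq_withDensity {ι : Type*} [Fintype ι] :
    Measure.pi (fun _ : ι ↦ gaussianReal 0 1) =
      (volume : Measure (ι → ℝ)).withDensity
        (fun x ↦ ENNReal.ofReal (∏ i, gaussianPDFReal 0 1 (x i))) := by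
  refine Measure.pi_eq fun s hs ↦ ?_
  have hnn : ∀ x : ι → ℝ, 0 ≤ ∏ i, gaussianPDFReal 0 1 (x i) := fun x ↦
    Finset.prod_nonneg fun i _ ↦ gaussianPDFReal_nonneg 0 1 (x i)
  rw [withDensity_apply _ (MeasurableSet.univ_pi hs), volume_pi, Measure.restrict_pi_pi,
    ← ofReal_integral_eq_lintegral_ofReal, integral_fintype_prod_eq_prod,
    ENNReal.ofReal_prod_of_nonneg]
  · exact Finset.prod_congr rfl fun i _ ↦
      (gaussianReal_apply_eq_integral 0 one_ne_zero (s i)).symm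
  · exact fun i _ ↦ integral_nonneg fun x ↦ gaussianPDFReal_nonneg 0 1 x
  · exact Integrable.fintype_prod fun i ↦ (integrable_gaussianPDFReal 0 1).restrict
  · exact Filter.Eventually.of_forall hnn

/-- The standard Gaussian measure on Euclidean space has a radial density. -/
lemma stdGaussian_eq_withDensity_norm {ι : Type*} [Fintype ι] :
    stdGaussian (EuclideanSpace ℝ ι) =
      (volume : Measure (EuclideanSpace ℝ ι)).withDensity
        (fun x ↦ ENNReal.ofReal ((√(2 * π))⁻¹ ^ Fintype.card ι * rexp (-‖x‖ ^ 2 / 2))) := by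
  rw [← map_pi_eq_stdGaussian, pi_gaussianReal_eq_withDensity]
  ext s hs
  rw [Measure.map_apply (by fun_prop) hs, withDensity_apply _ hs,
    withDensity_apply _ (hs.preimage (by fun_prop)),
    ← (PiLp.volume_preserving_toLp ι).setLIntegral_comp_preimage hs (by fun_prop)]
  refine lintegral_congr fun x ↦ ?_
  congr 1
  simp only [gaussianPDFReal, Finset.prod_mul_distrib, ← Real.exp_sum, EuclideanSpace.real_norm_sq_eq]
  simp [Finset.sum_div, neg_div]

/-- Integration in polar coordinates of a product of an angular and a radial function. -/
lemma lintegral_angular_mul_radial {E : Type*} [NormedAddCommGroup E] [NormedSpace ℝ E]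
    [MeasurableSpace E] [BorelSpace E] [FiniteDimensional ℝ E] [Nontrivial E]
    (μ : Measure E) [μ.IsAddHaarMeasure] {g : E → ENNReal} {ρ : ℝ → ENNReal}
    (hg : Measurable g) (hρ : Measurable ρ) :
    ∫⁻ x, g (‖x‖⁻¹ • x) * ρ ‖x‖ ∂μ =
      (∫⁻ s, g (s : E) ∂μ.toSphere) *
        ∫⁻ r, ρ (r : ℝ) ∂Measure.volumeIoiPow (Module.finrank ℝ E - 1) := by
  have h := μ.measurePreserving_homeomorphUnitSphereProd.lintegral_comp_emb
    (Homeomorph.measurableEmbedding _)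
    (fun p : Metric.sphere (0 : E) 1 × Set.Ioi (0 : ℝ) ↦ g p.1 * ρ p.2)
  rw [lintegral_prod_mul (f := fun s : Metric.sphere (0 : E) 1 ↦ g s)
    (g := fun r : Set.Ioi (0 : ℝ) ↦ ρ r) (by fun_prop) (by fun_prop)] at h
  rw [← h, ← restrict_compl_singleton (μ := μ) 0,
    ← lintegral_subtype_comap (measurableSet_singleton _).compl]
  simp

/-- The uniform distribution on the sphere is the law of the direction of a Gaussian vector. -/
lemma toSphere_eq_stdGaussian_direction {ι : Type*} [Fintype ι] [Nonempty ι]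
    {B : Set (EuclideanSpace ℝ ι)} (hB : MeasurableSet B) :
    ((volume : Measure (EuclideanSpace ℝ ι)).toSphere Set.univ)⁻¹ *
        (volume : Measure (EuclideanSpace ℝ ι)).toSphere (Subtype.val ⁻¹' B) =
      stdGaussian (EuclideanSpace ℝ ι) {x | ‖x‖⁻¹ • x ∈ B} := by
  let E := EuclideanSpace ℝ ι
  let σ := (volume : Measure E).toSphere
  let ρ : ℝ → ENNReal := fun r ↦
    ENNReal.ofReal ((√(2 * π))⁻¹ ^ Fintype.card ι * rexp (-r ^ 2 / 2))
  have hρ : Measurable ρ := by fun_prop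
  have key : ∀ C : Set E, MeasurableSet C → stdGaussian E {x | ‖x‖⁻¹ • x ∈ C} =
      σ (Subtype.val ⁻¹' C) *
        ∫⁻ r, ρ (r : ℝ) ∂Measure.volumeIoiPow (Module.finrank ℝ E - 1) := by
    intro C hC
    have hm : MeasurableSet {x : E | ‖x‖⁻¹ • x ∈ C} :=
      hC.preimage (f := fun x : E ↦ ‖x‖⁻¹ • x) (by fun_prop)
    have h := lintegral_angular_mul_radial (volume : Measure E)
      (g := C.indicator 1) (measurable_one.indicator hC) hρ
    have h1 : ∫⁻ s, C.indicator (1 : E → ENNReal) (s : E) ∂σ = σ (Subtype.val ⁻¹' C) := by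
      rw [← lintegral_indicator_one (hC.preimage measurable_subtype_coe)]
      rfl
    rw [h1] at h
    rw [← h, stdGaussian_eq_withDensity_norm, withDensity_apply _ hm, ← lintegral_indicator hm]
    refine lintegral_congr fun x ↦ ?_
    by_cases hx : ‖x‖⁻¹ • x ∈ C <;> simp [Set.indicator, hx, ρ]
  have h1 := key Set.univ MeasurableSet.univ
  simp only [Set.mem_univ, Set.ofPred_true, measure_univ, Set.preimage_univ] at h1
  change (σ Set.univ)⁻¹ * σ (Subtype.val ⁻¹' B) = stdGaussian E {x | ‖x‖⁻¹ • x ∈ B}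
  rw [key B hB, mul_comm]
  congr 1
  exact (ENNReal.eq_inv_of_mul_eq_one_left ((mul_comm _ _).trans h1.symm)).symm

lemma gaussianReal_real_abs_ge {r : ℝ} (hr : 0 ≤ r) :
    (gaussianReal 0 1).real {z | r ≤ |z|} = 1 - 2 * ∫ x in (0)..r, gaussianPDFReal 0 1 x := by
  have hi : ∀ a b : ℝ, IntervalIntegrable (gaussianPDFReal 0 1) volume a b := fun a b ↦
    (integrable_gaussianPDFReal 0 1).intervalIntegrable
  have hset : {z : ℝ | r ≤ |z|} = (Set.Ioo (-r) r)ᶜ := by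
    ext z
    simp [← abs_lt, -Set.mem_Ioo, Set.mem_compl_iff, Set.mem_Ioo]
  have hneg : ∫ x in (-r)..0, gaussianPDFReal 0 1 x = ∫ x in (0)..r, gaussianPDFReal 0 1 x := by
    have := intervalIntegral.integral_comp_neg (a := 0) (b := r) (gaussianPDFReal 0 1)
    rw [neg_zero] at this
    rw [← this]
    simp [gaussianPDFReal]
  rw [hset, measureReal_compl measurableSet_Ioo, probReal_univ, Measure.real,
    gaussianReal_apply_eq_integral 0 one_ne_zero, ENNReal.toReal_ofReal
      (integral_nonneg fun x ↦ gaussianPDFReal_nonneg 0 1 x), ← integral_Ioc_eq_integral_Ioo,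
    ← intervalIntegral.integral_of_le (by linarith),
    ← intervalIntegral.integral_add_adjacent_intervals (hi (-r) 0) (hi 0 r), hneg]
  ring

/-- The two-sided Gaussian tail, as a function of the squared threshold, lies above its tangents. -/
lemma gaussianReal_tail_tangent {r₀ : ℝ} (h₀ : 0 < r₀) :
    ∃ k : ℝ, ∀ r : ℝ, 0 ≤ r → (gaussianReal 0 1).real {z | r₀ ≤ |z|} - k * (r ^ 2 - r₀ ^ 2) ≤
      (gaussianReal 0 1).real {z | r ≤ |z|} := by
  set φ := gaussianPDFReal 0 1 with hφ
  have hi : ∀ a b : ℝ, IntervalIntegrable φ volume a b := fun a b ↦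
    (integrable_gaussianPDFReal 0 1).intervalIntegrable
  have hanti : ∀ {x y : ℝ}, 0 ≤ x → x ≤ y → φ y ≤ φ x := by
    intro x y hx hxy
    simp only [hφ, gaussianPDFReal]
    gcongr
  have hpos : 0 < φ r₀ := gaussianPDFReal_pos 0 1 r₀ one_ne_zero
  refine ⟨φ r₀ / r₀, fun r hr ↦ ?_⟩
  set k := φ r₀ / r₀ with hk
  have hk0 : 0 < k := by positivity
  have hkr : k * r₀ = φ r₀ := by rw [hk]; field_simp
  have hlin : ∀ a b : ℝ, ∫ x in a..b, k * x = k * ((b ^ 2 - a ^ 2) / 2) := fun a b ↦ by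
    rw [intervalIntegral.integral_const_mul, integral_id]
  have hli : ∀ a b : ℝ, IntervalIntegrable (fun x ↦ k * x) volume a b := fun a b ↦
    (continuous_const.mul continuous_id).intervalIntegrable a b
  rw [gaussianReal_real_abs_ge hr, gaussianReal_real_abs_ge h₀.le]
  rcases le_total r r₀ with h | h
  · have h1 := intervalIntegral.integral_add_adjacent_intervals (hi 0 r) (hi r r₀)
    have h2 := intervalIntegral.integral_mono_on h (hli r r₀) (hi r r₀) fun x hx ↦ by
      have := hanti (hr.trans hx.1) hx.2
      nlinarith [hx.2]
    rw [hlin] at h2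
    linarith
  · have h1 := intervalIntegral.integral_add_adjacent_intervals (hi 0 r₀) (hi r₀ r)
    have h2 := intervalIntegral.integral_mono_on h (hi r₀ r) (hli r₀ r) fun x hx ↦ by
      have := hanti h₀.le hx.1
      nlinarith [hx.1]
    rw [hlin] at h2
    linarith

lemma integrable_sum_sq_pi_gaussianReal {ι : Type*} [Fintype ι] :
    Integrable (fun y : ι → ℝ ↦ ∑ i, y i ^ 2) (Measure.pi fun _ ↦ gaussianReal 0 1) :=
  integrable_finsetSum _ fun i _ ↦ integrable_comp_eval (i := i)
    (μ := fun _ : ι ↦ gaussianReal 0 1) (f := fun x ↦ x ^ 2) (memLp_id_gaussianReal 2).integrable_sq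

lemma integral_sum_sq_pi_gaussianReal {ι : Type*} [Fintype ι] :
    ∫ y : ι → ℝ, ∑ i, y i ^ 2 ∂(Measure.pi fun _ ↦ gaussianReal 0 1) = Fintype.card ι := by
  have h1 : ∫ x, x ^ 2 ∂gaussianReal 0 1 = 1 := by
    have := variance_fun_id_gaussianReal (μ := 0) (v := 1)
    rw [variance_of_integral_eq_zero (by fun_prop) integral_id_gaussianReal] at this
    simpa using this
  rw [integral_finsetSum _ fun i _ ↦ integrable_comp_eval (i := i)
    (μ := fun _ : ι ↦ gaussianReal 0 1) (f := fun x ↦ x ^ 2) (memLp_id_gaussianReal 2).integrable_sq]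
  have h2 (i : ι) : ∫ y : ι → ℝ, y i ^ 2 ∂(Measure.pi fun _ ↦ gaussianReal 0 1) = 1 :=
    (integral_comp_eval (i := i) (μ := fun _ : ι ↦ gaussianReal 0 1) (f := fun x ↦ x ^ 2)
      (by fun_prop)).trans h1
  simp [h2]

lemma ofReal_integral_le_lintegral_ofReal {α : Type*} [MeasurableSpace α] {μ : Measure α}
    {f : α → ℝ} (hf : Integrable f μ) :
    ENNReal.ofReal (∫ x, f x ∂μ) ≤ ∫⁻ x, ENNReal.ofReal (f x) ∂μ := by
  rw [integral_eq_lintegral_pos_part_sub_lintegral_neg_part hf]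
  exact (ENNReal.ofReal_le_ofReal (sub_le_self _ ENNReal.toReal_nonneg)).trans
    ENNReal.ofReal_toReal_le

/-- Replacing the sum of squares of independent Gaussians by its mean decreases the tail of a
further Gaussian: the Student distribution has heavier tails than the Gaussian. -/
lemma gaussianReal_tail_le_prod {ι : Type*} [Fintype ι] [Nonempty ι] {a : ℝ} (ha : 0 < a) :
    gaussianReal 0 1 {z | √(a * Fintype.card ι) ≤ |z|} ≤
      ((gaussianReal 0 1).prod (Measure.pi fun _ : ι ↦ gaussianReal 0 1))
        {p | √(a * ∑ i, p.2 i ^ 2) ≤ |p.1|} := by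
  set γ := gaussianReal 0 1
  set ν := Measure.pi fun _ : ι ↦ γ
  have hm : MeasurableSet {p : ℝ × (ι → ℝ) | √(a * ∑ i, p.2 i ^ 2) ≤ |p.1|} :=
    measurableSet_le (by fun_prop) (by fun_prop)
  have hc : (0 : ℝ) < Fintype.card ι := by exact_mod_cast Fintype.card_pos
  obtain ⟨k, hk⟩ := gaussianReal_tail_tangent (Real.sqrt_pos.2 (mul_pos ha hc))
  have hint : Integrable (fun y : ι → ℝ ↦ γ.real {z | √(a * Fintype.card ι) ≤ |z|} -
      k * (a * ∑ i, y i ^ 2 - a * Fintype.card ι)) ν :=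
    (integrable_const _).sub (((integrable_sum_sq_pi_gaussianReal.const_mul a).sub
      (integrable_const _)).const_mul k)
  have hval : ∫ y : ι → ℝ, (γ.real {z | √(a * Fintype.card ι) ≤ |z|} -
      k * (a * ∑ i, y i ^ 2 - a * Fintype.card ι)) ∂ν =
      γ.real {z | √(a * Fintype.card ι) ≤ |z|} := by
    have hS := integrable_sum_sq_pi_gaussianReal (ι := ι).const_mul a
    have hSc : Integrable (fun y : ι → ℝ ↦ k * (a * ∑ i, y i ^ 2 - a * Fintype.card ι)) ν :=
      (hS.sub (integrable_const _)).const_mul k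
    rw [integral_sub (integrable_const _) hSc, integral_const_mul,
      integral_sub hS (integrable_const _), integral_const_mul, integral_sum_sq_pi_gaussianReal]
    simp
  rw [Measure.prod_apply_symm hm, ← ofReal_measureReal, ← hval]
  refine (ofReal_integral_le_lintegral_ofReal hint).trans ?_
  refine lintegral_mono fun y ↦ ENNReal.ofReal_le_of_le_toReal ?_
  have h := hk (√(a * ∑ i, y i ^ 2)) (Real.sqrt_nonneg _)
  rwa [Real.sq_sqrt (by positivity), Real.sq_sqrt (by positivity)] at h

/-- The first coordinate of the direction of a Gaussian vector has heavier tails than a suitably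
scaled Gaussian. -/
lemma gaussianReal_tail_le_stdGaussian_direction {m : ℕ} (hm : 1 ≤ m) {c : ℝ} (hc0 : 0 < c)
    (hc1 : c ≤ 1) :
    gaussianReal 0 1 {y : ℝ | √c ≤ |y|} ≤ stdGaussian (EuclideanSpace ℝ (Fin (m + 1)))
      {x | ‖x‖⁻¹ • x ∈ {x | √(c / (m + 1 : ℕ)) ≤ |x 0|}} := by
  have : Nonempty (Fin m) := ⟨⟨0, hm⟩⟩
  have hm' : (1 : ℝ) ≤ m := by exact_mod_cast hm
  set a : ℝ := c / (m + 1 - c) with ha_def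
  have hden : 0 < (m : ℝ) + 1 - c := by linarith
  have ha : 0 < a := by positivity
  have hle : a * m ≤ c := by
    rw [ha_def, div_mul_eq_mul_div, div_le_iff₀ hden]
    nlinarith
  set B : Set (EuclideanSpace ℝ (Fin (m + 1))) := {x | √(c / (m + 1 : ℕ)) ≤ |x 0|}
  have hB : MeasurableSet B := measurableSet_le (by fun_prop) (by fun_prop)
  have hBn : MeasurableSet {x : EuclideanSpace ℝ (Fin (m + 1)) | ‖x‖⁻¹ • x ∈ B} :=
    hB.preimage (f := fun x : EuclideanSpace ℝ (Fin (m + 1)) ↦ ‖x‖⁻¹ • x) (by fun_prop)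
  have hmp := measurePreserving_piFinSuccAbove (fun _ : Fin (m + 1) ↦ gaussianReal 0 1) 0
  calc gaussianReal 0 1 {y : ℝ | √c ≤ |y|}
    _ ≤ gaussianReal 0 1 {z | √(a * Fintype.card (Fin m)) ≤ |z|} := by
      refine measure_mono fun y (hy : √c ≤ |y|) ↦ (Real.sqrt_le_sqrt ?_).trans hy
      simpa using hle
    _ ≤ _ := gaussianReal_tail_le_prod ha
    _ = (Measure.pi fun _ : Fin (m + 1) ↦ gaussianReal 0 1)
        {x | √(a * ∑ i : Fin m, x i.succ ^ 2) ≤ |x 0|} := by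
      rw [← hmp.measure_preimage (measurableSet_le (by fun_prop) (by fun_prop)).nullMeasurableSet]
      rfl
    _ ≤ (Measure.pi fun _ : Fin (m + 1) ↦ gaussianReal 0 1)
        (WithLp.toLp 2 ⁻¹' {x | ‖x‖⁻¹ • x ∈ B}) := by
      have hne : ∀ᵐ x : Fin (m + 1) → ℝ ∂(Measure.pi fun _ ↦ gaussianReal 0 1), x 0 ≠ 0 := by
        have := nullSingletonClass_gaussianReal (μ := 0) (v := 1) one_ne_zero
        refine (measurePreserving_eval (fun _ : Fin (m + 1) ↦ gaussianReal 0 1) 0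
          ).quasiMeasurePreserving.ae (p := fun z ↦ z ≠ 0) ?_
        exact Measure.ae_ne _ 0
      refine measure_mono_ae ?_
      filter_upwards [hne] with x hx0 (hx : √(a * ∑ i : Fin m, x i.succ ^ 2) ≤ |x 0|)
      change √(c / (m + 1 : ℕ)) ≤ |‖WithLp.toLp 2 x‖⁻¹ * x 0|
      have hn : ‖WithLp.toLp 2 x‖ ^ 2 = x 0 ^ 2 + ∑ i : Fin m, x i.succ ^ 2 := by
        rw [EuclideanSpace.real_norm_sq_eq, Fin.sum_univ_succ]
      have hn0 : 0 < ‖WithLp.toLp 2 x‖ ^ 2 := by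
        rw [hn]; positivity
      rw [Real.sqrt_le_left (abs_nonneg _), sq_abs] at hx
      rw [Real.sqrt_le_left (abs_nonneg _), sq_abs, mul_pow, inv_pow, inv_mul_eq_div,
        div_le_div_iff₀ (by positivity) hn0, hn]
      rw [ha_def, div_mul_eq_mul_div, div_le_iff₀ hden] at hx
      push_cast
      linarith
    _ = _ := by
      rw [← map_pi_eq_stdGaussian, Measure.map_apply (by fun_prop) hBn]

theorem random_point_on_sphere {Ω : Type*} [MeasurableSpace Ω] (P : Measure Ω)
    [IsProbabilityMeasure P] (d : ℕ) (hd : 2 ≤ d)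
    (u : Ω → Metric.sphere (0 : EuclideanSpace ℝ (Fin d)) 1)
    (hu : Measure.map u P =
      ((volume : Measure (EuclideanSpace ℝ (Fin d))).toSphere Set.univ)⁻¹ •
        (volume : Measure (EuclideanSpace ℝ (Fin d))).toSphere)
    (c : ℝ) (hc0 : 0 < c) (hc1 : c ≤ 1) :
    gaussianReal 0 1 {y : ℝ | Real.sqrt c ≤ |y|} ≤
      P {ω | Real.sqrt (c / d) ≤ |(u ω : EuclideanSpace ℝ (Fin d)) ⟨0, by omega⟩|} := by
  obtain ⟨m, rfl⟩ : ∃ m, d = m + 1 := ⟨d - 1, by omega⟩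
  set B : Set (EuclideanSpace ℝ (Fin (m + 1))) := {x | √(c / (m + 1 : ℕ)) ≤ |x 0|}
  have hB : MeasurableSet B := measurableSet_le (by fun_prop) (by fun_prop)
  have hum : AEMeasurable u P := by
    refine AEMeasurable.of_map_ne_zero ?_
    rw [hu]
    rw [← Measure.measure_univ_ne_zero, Measure.smul_apply, smul_eq_mul]
    exact mul_ne_zero (ENNReal.inv_ne_zero.2 (measure_ne_top _ _))
      (Measure.measure_univ_ne_zero.2 (Measure.toSphere_ne_zero _))
  have h := gaussianReal_tail_le_stdGaussian_direction (by omega : 1 ≤ m) hc0 hc1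
  rw [← toSphere_eq_stdGaussian_direction hB, ← smul_eq_mul, ← Measure.smul_apply, ← hu,
    Measure.map_apply_of_aemeasurable hum (hB.preimage measurable_subtype_coe)] at h
  exact h
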